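/- arXiv:1707.06343 — 2 statements merged into one kernel-verified Lean document; each statement's English description precedes it below -/
import Mathlib

section
/- Consider the black-white pebble game on the graph H_{n,k} (with k < √n and 2k dividing n−k). Any strategy that pebbles the target v_n using at most k pebbles and has the minimum possible number of moves among all such strategies never places a white pebble on v_n. -/
/-- One legal move of the black-white pebble game on a DAG with edge relation
`E` (edges directed `u → v` meaning `u` is an immediate predecessor of `v`),
taking the configuration `(B, W)` of disjoint sets of black- and white-pebbled
vertices to `(B', W')`. One may: place a black pebble on a vertex all of whose
immediate predecessors are pebbled (any source vacuously); remove a black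
pebble from any vertex; place a white pebble on any empty vertex; remove a
white pebble from a vertex all of whose immediate predecessors are pebbled
(any source vacuously); slide a black pebble from `v` to `w` along edge
`(v, w)` when all immediate predecessors of `w` are pebbled; or slide a white
pebble from `w` to `v` along edge `(v, w)` when all immediate predecessors of
`w` other than `v` are pebbled and `v` is empty. -/
def BWMove {V : Type} [DecidableEq V] (E : V → V → Prop)
    (B W B' W' : Finset V) : Prop :=
  (∃ v, v ∉ B ∧ v ∉ W ∧ (∀ u, E u v → u ∈ B ∪ W) ∧ B' = insert v B ∧ W' = W) ∨
  (∃ v, v ∈ B ∧ B' = B.erase v ∧ W' = W) ∨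
  (∃ v, v ∉ B ∧ v ∉ W ∧ B' = B ∧ W' = insert v W) ∨
  (∃ v, v ∈ W ∧ (∀ u, E u v → u ∈ B ∪ W) ∧ B' = B ∧ W' = W.erase v) ∨
  (∃ v w, v ∈ B ∧ w ∉ B ∧ w ∉ W ∧ E v w ∧ (∀ u, E u w → u ∈ B ∪ W) ∧
    B' = insert w (B.erase v) ∧ W' = W) ∨
  (∃ v w, w ∈ W ∧ v ∉ B ∧ v ∉ W ∧ E v w ∧ (∀ u, E u w → u ≠ v → u ∈ B ∪ W) ∧
    B' = B ∧ W' = insert v (W.erase w))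
/-- `Hf n k l = (k − 1) + (l − 1)·(n − k)/k + 2`, the index offset of level `l`
in the graph `H_{n,k}`. -/
def Hf (n k l : ℕ) : ℕ := (k - 1) + (l - 1) * ((n - k) / k) + 2

/-- The edge relation of the graph `H_{n,k}` on the vertices `v_1, …, v_n`
(represented by their indices `1, …, n`):
(1) `v_i → v_{i+1}` for `k − 1 ≤ i ≤ n − 1`;
(2) `v_i → v_j` for every `2 ≤ l ≤ k`, `1 ≤ i ≤ l − 1`, and
    `j = Hf n k l + 2r − 2` with `1 ≤ r ≤ (n − k)/(2k)`;
(3) `v_i → v_j` for `i = Hf n k l − 2` and `j = Hf n k l + 2r − 1` for every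
    `1 ≤ l ≤ k − 1` and `0 ≤ r ≤ (n − k)/(2k) − 1`. -/
def HEdge (n k : ℕ) (i j : ℕ) : Prop :=
  (k - 1 ≤ i ∧ i ≤ n - 1 ∧ j = i + 1) ∨
  (∃ l r, 2 ≤ l ∧ l ≤ k ∧ 1 ≤ i ∧ i ≤ l - 1 ∧ 1 ≤ r ∧ r ≤ (n - k) / (2 * k) ∧
    j = Hf n k l + 2 * r - 2) ∨
  (∃ l r, 1 ≤ l ∧ l ≤ k - 1 ∧ i = Hf n k l - 2 ∧ r + 1 ≤ (n - k) / (2 * k) ∧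
    j = Hf n k l + 2 * r - 1)


/-- A valid black-white pebbling strategy of `τ` moves on `H_{n,k}` that
pebbles the target `v_n` using at most `k` pebbles: configurations are pairs
of disjoint subsets of the vertex set `{1, …, n}`, starting at `(∅, ∅)`,
ending at `({v_n}, ∅)`, each step a legal move, and at most `k` pebbles are
ever on the graph. -/
def BWStrategy (n k : ℕ) (τ : ℕ) (B W : ℕ → Finset ℕ) : Prop :=
  B 0 = ∅ ∧ W 0 = ∅ ∧ B τ = {n} ∧ W τ = ∅ ∧
  (∀ i ≤ τ, B i ⊆ Finset.Icc 1 n ∧ W i ⊆ Finset.Icc 1 n) ∧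
  (∀ i ≤ τ, Disjoint (B i) (W i)) ∧
  (∀ i < τ, BWMove (HEdge n k) (B i) (W i) (B (i + 1)) (W (i + 1))) ∧
  (∀ i ≤ τ, (B i).card + (W i).card ≤ k)

/-- A sequence whose steps are either `R`-steps or stationary can be compressed to a sequence of
`R`-steps through the same points, which is strictly shorter if some step is stationary. -/
theorem exists_chain_of_stationary_steps {α : Type*} (R : α → α → Prop) (f : ℕ → α) (τ : ℕ)
    (hf : ∀ i < τ, R (f i) (f (i + 1)) ∨ f i = f (i + 1)) :
    ∃ (σ : ℕ) (g : ℕ → α), g 0 = f 0 ∧ g σ = f τ ∧ (∀ i < σ, R (g i) (g (i + 1))) ∧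
      (∀ i ≤ σ, ∃ j ≤ τ, g i = f j) ∧ σ ≤ τ ∧ ((∃ i < τ, f i = f (i + 1)) → σ < τ) := by
  classical
  induction τ with
  | zero => exact ⟨0, f, rfl, rfl, by simp, fun i hi => ⟨i, hi, rfl⟩, le_rfl, by simp⟩
  | succ τ ih =>
    obtain ⟨σ, g, h0, hσ, hR, hmem, hle, hlt⟩ := ih fun i hi => hf i (by omega)
    by_cases heq : f τ = f (τ + 1)
    · refine ⟨σ, g, h0, hσ.trans heq, hR, fun i hi => ?_, by omega, fun _ => by omega⟩
      obtain ⟨j, hj, hgj⟩ := hmem i hi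
      exact ⟨j, by omega, hgj⟩
    · have hstep := (hf τ (by omega)).resolve_right heq
      refine ⟨σ + 1, fun i => if i ≤ σ then g i else f (τ + 1), by simpa using h0, by simp,
        fun i hi => ?_, fun i hi => ?_, by omega, ?_⟩
      · rcases Nat.lt_succ_iff_lt_or_eq.mp hi with h | rfl
        · simpa [h.le, Nat.succ_le_of_lt h] using hR i h
        · simpa [hσ] using hstep
      · by_cases h : i ≤ σ
        · obtain ⟨j, hj, hgj⟩ := hmem i h
          exact ⟨j, by omega, by simpa [h] using hgj⟩
        · exact ⟨τ + 1, le_rfl, by simp [h]⟩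
      · rintro ⟨i, hi, hfi⟩
        rcases Nat.lt_succ_iff_lt_or_eq.mp hi with h | rfl
        · have := hlt ⟨i, h, hfi⟩
          omega
        · exact absurd hfi heq

/-- Ignoring white pebbles on a vertex `t` without outgoing edges turns a legal move into a legal
move or into no move at all. -/
theorem BWMove.erase_white {V : Type} [DecidableEq V] {E : V → V → Prop} {B W B' W' : Finset V}
    {t : V} (ht : ∀ v, ¬ E t v) (h : BWMove E B W B' W') :
    BWMove E B (W.erase t) B' (W'.erase t) ∨ (B = B' ∧ W.erase t = W'.erase t) := by
  have hpred : ∀ {u v : V}, E u v → u ∈ B ∪ W → u ∈ B ∪ W.erase t := by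
    intro u v huv hu
    have : u ≠ t := by
      rintro rfl
      exact ht v huv
    simpa [this] using hu
  rcases h with ⟨v, hB, hW, hp, rfl, rfl⟩ | ⟨v, hB, rfl, rfl⟩ | ⟨v, hB, hW, rfl, rfl⟩ |
    ⟨v, hW, hp, rfl, rfl⟩ | ⟨v, w, hv, hwB, hwW, he, hp, rfl, rfl⟩ |
    ⟨v, w, hw, hvB, hvW, he, hp, rfl, rfl⟩
  · exact .inl (.inl ⟨v, hB, by simp [hW], fun u hu => hpred hu (hp u hu), rfl, rfl⟩)
  · exact .inl (.inr (.inl ⟨v, hB, rfl, rfl⟩))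
  · by_cases hvt : v = t
    · subst hvt
      exact .inr ⟨rfl, by simp⟩
    · exact .inl (.inr (.inr (.inl ⟨v, hB, by simp [hW], rfl, Finset.erase_insert_of_ne hvt⟩)))
  · by_cases hvt : v = t
    · subst hvt
      exact .inr ⟨rfl, by simp⟩
    · exact .inl (.inr (.inr (.inr (.inl ⟨v, by simp [hW, hvt],
        fun u hu => hpred hu (hp u hu), rfl, Finset.erase_right_comm⟩))))
  · exact .inl (.inr (.inr (.inr (.inr (.inl ⟨v, w, hv, hwB, by simp [hwW], he,
      fun u hu => hpred hu (hp u hu), rfl, rfl⟩)))))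
  · have hvt : v ≠ t := by
      rintro rfl
      exact ht w he
    by_cases hwt : w = t
    · subst hwt
      refine .inl (.inr (.inr (.inl ⟨v, hvB, by simp [hvW], rfl, ?_⟩)))
      rw [Finset.erase_insert_of_ne hvt, Finset.erase_idem]
    · refine .inl (.inr (.inr (.inr (.inr (.inr ⟨v, w, by simp [hw, hwt], hvB, by simp [hvW], he,
        fun u hu huv => hpred hu (hp u hu huv), rfl, ?_⟩)))))
      rw [Finset.erase_insert_of_ne hvt, Finset.erase_right_comm]

/-- A move that puts a white pebble on a vertex `t` without outgoing edges changes nothing else. -/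
theorem BWMove.eq_of_white_placed {V : Type} [DecidableEq V] {E : V → V → Prop}
    {B W B' W' : Finset V} {t : V} (ht : ∀ v, ¬ E t v) (h : BWMove E B W B' W')
    (hW : t ∉ W) (hW' : t ∈ W') : B = B' ∧ W.erase t = W'.erase t := by
  rcases h with ⟨v, -, -, -, -, rfl⟩ | ⟨v, -, -, rfl⟩ | ⟨v, -, -, rfl, rfl⟩ |
    ⟨v, -, -, -, rfl⟩ | ⟨v, w, -, -, -, -, -, -, rfl⟩ | ⟨v, w, -, -, -, he, -, -, rfl⟩
  · exact absurd hW' hW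
  · exact absurd hW' hW
  · obtain rfl : t = v := by simpa [hW] using hW'
    exact ⟨rfl, by simp⟩
  · exact absurd (Finset.mem_of_mem_erase hW') hW
  · exact absurd hW' hW
  · obtain rfl : t = v := by simpa [hW] using hW'
    exact absurd he (ht w)

/-- The target `v_n` of `H_{n,k}` has no outgoing edges. -/
theorem not_HEdge_target {n k : ℕ} (hk : k * k < n) (j : ℕ) : ¬ HEdge n k n j := by
  have hkk : k ≤ k * k := Nat.le_mul_self k
  rintro (⟨-, h, -⟩ | ⟨l, r, -, hl, -, h, -⟩ | ⟨l, r, hl, hlk, h, -⟩)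
  · omega
  · omega
  · have h1 : k * ((n - k) / k) ≤ n - k := Nat.mul_div_le _ _
    have h2 : (l - 1) * ((n - k) / k) ≤ k * ((n - k) / k) :=
      Nat.mul_le_mul_right _ (by omega)
    unfold Hf at h
    omega

/-- In the black-white pebble game on `H_{n,k}` (with `k < √n` and
`2k ∣ n − k`), any strategy pebbling the target `v_n` with at most `k` pebbles
that has the minimum possible number of moves among all such strategies never
places a white pebble on `v_n`. -/
theorem H_graph_bw_min_no_white_on_target
    (n k : ℕ) (hk : k * k < n) (hdvd : 2 * k ∣ n - k)
    (τ : ℕ) (B W : ℕ → Finset ℕ)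
    (hstrat : BWStrategy n k τ B W)
    (hmin : ∀ (τ' : ℕ) (B' W' : ℕ → Finset ℕ), BWStrategy n k τ' B' W' → τ ≤ τ') :
    ∀ i ≤ τ, n ∉ W i := by
  obtain ⟨hB0, hW0, hBτ, hWτ, hsub, hdisj, hmove, hcard⟩ := hstrat
  have ht := not_HEdge_target hk
  intro m hm hmem
  obtain ⟨a, haτ, hWa, hWa'⟩ : ∃ a < τ, n ∉ W a ∧ n ∈ W (a + 1) := by
    by_contra! hno
    have hall : ∀ i ≤ τ, n ∉ W i := by
      intro i
      induction i with
      | zero => simp [hW0]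
      | succ i ih => exact fun hi => hno i (by omega) (ih (by omega))
    exact hall m hm hmem
  obtain ⟨σ, g, hg0, hgσ, hgmove, hgmem, -, hlt⟩ := exists_chain_of_stationary_steps
    (fun p q : Finset ℕ × Finset ℕ => BWMove (HEdge n k) p.1 p.2 q.1 q.2)
    (fun i => (B i, (W i).erase n)) τ fun i hi => by
      simpa only [Prod.mk.injEq] using (hmove i hi).erase_white ht
  have hστ : σ < τ := hlt ⟨a, haτ, by
    simpa only [Prod.mk.injEq] using (hmove a haτ).eq_of_white_placed ht hWa hWa'⟩
  refine absurd (hmin σ (fun i => (g i).1) (fun i => (g i).2)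
    ⟨by simp [hg0, hB0], by simp [hg0, hW0], by simp [hgσ, hBτ], by simp [hgσ, hWτ],
      fun i hi => ?_, fun i hi => ?_, hgmove, fun i hi => ?_⟩) (by omega)
  all_goals
    obtain ⟨j, hj, hgj⟩ := hgmem i hi
    simp only [hgj]
  · exact ⟨(hsub j hj).1, (Finset.erase_subset _ _).trans (hsub j hj).2⟩
  · exact (hdisj j hj).mono_right (Finset.erase_subset _ _)
  · exact (Nat.add_le_add_left (Finset.card_le_card (Finset.erase_subset _ _)) _).trans (hcard j hj)
end

section
/- Let h ≥ 1 be odd. In the black-white pebble game on the complete binary tree T_h of height h, any valid strategy whose first move places a white pebble on the root and which ends with no pebbles on the tree (so that the white pebble on the root is eventually legally removed) uses at least ⌊(h+3)/2⌋ pebbles, and ⌊(h+3)/2⌋ pebbles suffice for such a strategy; that is, the cost of pebbling the root of T_h in the first step using a white pebble is exactly ⌊(h+3)/2⌋. -/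
/-- The edge relation of the complete binary tree `T_h` of height `h`, with
`2^{h+1} − 1` vertices in heap numbering (root `1`, children of `v` are `2v`
and `2v + 1`), all edges directed from children to parents; the leaves are the
sources and the root is the unique sink. -/
def TreeEdge (h : ℕ) (u v : ℕ) : Prop :=
  2 ≤ u ∧ u ≤ 2 ^ (h + 1) - 1 ∧ v = u / 2

/-- `u` lies in the subtree hanging below `v`, in heap numbering. -/
def InSubtree (v u : ℕ) : Prop := ∃ j, u / 2 ^ j = v

lemma InSubtree.refl (v : ℕ) : InSubtree v v := ⟨0, by simp⟩

lemma InSubtree.of_half {v w u : ℕ} (h : InSubtree w u) (hw : w / 2 = v) : InSubtree v u := by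
  obtain ⟨j, rfl⟩ := h
  exact ⟨j + 1, by rw [pow_succ, ← Nat.div_div_eq_div_mul, hw]⟩

lemma InSubtree.le {v u : ℕ} (h : InSubtree v u) : v ≤ u := by
  obtain ⟨j, rfl⟩ := h
  exact Nat.div_le_self _ _

lemma InSubtree.not_of_lt {v u : ℕ} (h : u < v) : ¬ InSubtree v u :=
  fun hs => absurd hs.le (by omega)

/-- Subtrees of two vertices on the same level which share a vertex coincide. -/
lemma InSubtree.unique {x y u : ℕ} (hx : InSubtree x u) (hy : InSubtree y u)
    (hxy : y < 2 * x) (hyx : x < 2 * y) : x = y := by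
  have key : ∀ {x y i j : ℕ}, u / 2 ^ i = x → u / 2 ^ j = y → x < 2 * y → j ≤ i := by
    intro x y i j h₁ h₂ hlt
    by_contra! hij
    obtain ⟨d, rfl⟩ := Nat.exists_eq_add_of_lt hij
    rw [pow_succ, pow_add, mul_assoc, ← Nat.div_div_eq_div_mul, h₁, mul_comm,
      ← Nat.div_div_eq_div_mul] at h₂
    have := Nat.div_le_self (x / 2) (2 ^ d)
    omega
  obtain ⟨i, hi⟩ := hx
  obtain ⟨j, hj⟩ := hy
  obtain rfl : i = j := le_antisymm (key hj hi hxy) (key hi hj hyx)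
  exact hi.symm.trans hj

lemma InSubtree.of_grandchild {v a u : ℕ} (ha : a < 4) (h : InSubtree (4 * v + a) u) :
    InSubtree v u :=
  (h.of_half (v := 2 * v + a / 2) (by omega)).of_half (by omega)

open Classical in
/-- The number of pebbled vertices in the subtree below `v`. -/
noncomputable def subtreePebbles (P : Finset ℕ) (v : ℕ) : ℕ := (P.filter (InSubtree v)).card

open Classical in
lemma subtreePebbles_le_card (P : Finset ℕ) (v : ℕ) : subtreePebbles P v ≤ P.card :=
  Finset.card_le_card (Finset.filter_subset _ P)

open Classical in
lemma subtreePebbles_lt {P : Finset ℕ} {v w u : ℕ} (hvw : ∀ x, InSubtree w x → InSubtree v x)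
    (hu : u ∈ P) (huv : InSubtree v u) (huw : ¬ InSubtree w u) :
    subtreePebbles P w < subtreePebbles P v := by
  refine Finset.card_lt_card (Finset.ssubset_iff_of_subset ?_ |>.2 ⟨u, ?_, ?_⟩)
  · intro x hx
    rw [Finset.mem_filter] at hx ⊢
    exact ⟨hx.1, hvw x hx.2⟩
  · simp [hu, huv]
  · simp [huw]

open Classical in
lemma two_le_subtreePebbles {P : Finset ℕ} {v x y : ℕ} (hx : x ∈ P) (hy : y ∈ P) (hxy : x ≠ y)
    (hvx : InSubtree v x) (hvy : InSubtree v y) : 2 ≤ subtreePebbles P v := by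
  rw [← Finset.card_pair hxy]
  refine Finset.card_le_card fun z hz => ?_
  simp only [Finset.mem_insert, Finset.mem_singleton] at hz
  rcases hz with rfl | rfl <;> simp [*]

open Classical in
lemma subtreePebbles_eq_zero {P : Finset ℕ} {v : ℕ} (h : ∀ u ∈ P, ¬ InSubtree v u) :
    subtreePebbles P v = 0 := by
  simpa [subtreePebbles, Finset.filter_eq_empty_iff] using h

/-- A property that fails at `s` and holds at `t ≥ s` switches on at some step in between. -/
lemma exists_switch {p : ℕ → Prop} {s t : ℕ} (hst : s ≤ t) (hs : ¬ p s) (ht : p t) :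
    ∃ i, s ≤ i ∧ i < t ∧ ¬ p i ∧ p (i + 1) := by
  by_contra! hno
  have : ∀ n, s ≤ n → n ≤ t → ¬ p n := by
    intro n hn
    induction n, hn using Nat.le_induction with
    | base => exact fun _ => hs
    | succ n hn ih => exact fun hle => hno n hn (by omega) (ih (by omega))
  exact this t hst le_rfl ht

/-- When a vertex receives and later loses a pebble, then at some step either all its predecessors
are pebbled, or its white pebble slides to one predecessor while all others are pebbled. -/
lemma exists_preds_pebbled {V : Type} [DecidableEq V] {E : V → V → Prop} {B W : ℕ → Finset V}
    {s m t : ℕ} (hmove : ∀ i, s ≤ i → i < t → BWMove E (B i) (W i) (B (i + 1)) (W (i + 1)))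
    (hsm : s ≤ m) (hmt : m ≤ t) {v : V} (hs : v ∉ B s ∪ W s) (hm : v ∈ B m ∪ W m)
    (ht : v ∉ B t ∪ W t) :
    ∃ i, s ≤ i ∧ i < t ∧ ((∀ u, E u v → u ∈ B i ∪ W i) ∨
      ∃ w, E w v ∧ v ∈ B i ∪ W i ∧ (∀ u, E u v → u ≠ w → u ∈ B i ∪ W i) ∧
        w ∈ B (i + 1) ∪ W (i + 1)) := by
  simp only [Finset.mem_union, not_or] at hs ht
  rcases Finset.mem_union.1 hm with hm | hm
  · obtain ⟨i, hsi, him, h₀, h₁⟩ := exists_switch (p := fun i => v ∈ B i) hsm hs.1 hm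
    refine ⟨i, hsi, by omega, Or.inl ?_⟩
    rcases hmove i hsi (by omega) with ⟨x, -, -, hp, hB, -⟩ | ⟨x, -, hB, -⟩ | ⟨x, -, -, hB, -⟩ |
      ⟨x, -, -, hB, -⟩ | ⟨x, w, -, -, -, -, hp, hB, -⟩ | ⟨x, w, -, -, -, -, -, hB, -⟩ <;>
      rw [hB] at h₁
    · obtain rfl : v = x := by grind
      exact hp
    · grind
    · grind
    · grind
    · obtain rfl : v = w := by grind
      exact hp
    · grind
  · obtain ⟨i, hmi, hit, h₀, h₁⟩ := exists_switch (p := fun i => v ∉ W i) hmt (by simpa) ht.2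
    rw [not_not] at h₀
    refine ⟨i, by omega, hit, ?_⟩
    rcases hmove i (by omega) hit with ⟨x, -, -, -, -, hW⟩ | ⟨x, -, -, hW⟩ | ⟨x, -, -, -, hW⟩ |
      ⟨x, -, hp, -, hW⟩ | ⟨x, w, -, -, -, -, -, -, hW⟩ | ⟨x, w, -, -, -, hE, hp, -, hW⟩ <;>
      rw [hW] at h₁
    · grind
    · grind
    · grind
    · obtain rfl : v = x := by grind
      exact Or.inl hp
    · grind
    · obtain rfl : v = w := by grind
      refine Or.inr ⟨x, hE, by grind, hp, by grind⟩

lemma exists_pred_pebbled {V : Type} [DecidableEq V] {E : V → V → Prop} {B W : ℕ → Finset V}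
    {s m t : ℕ} (hmove : ∀ i, s ≤ i → i < t → BWMove E (B i) (W i) (B (i + 1)) (W (i + 1)))
    (hsm : s ≤ m) (hmt : m ≤ t) {u v : V} (hs : v ∉ B s ∪ W s) (hm : v ∈ B m ∪ W m)
    (ht : v ∉ B t ∪ W t) (hE : E u v) : ∃ i, s ≤ i ∧ i ≤ t ∧ u ∈ B i ∪ W i := by
  obtain ⟨i, hsi, hit, hp | ⟨w, -, -, hp, hw⟩⟩ := exists_preds_pebbled hmove hsm hmt hs hm ht
  · exact ⟨i, hsi, hit.le, hp u hE⟩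
  · by_cases huw : u = w
    · exact ⟨i + 1, by omega, by omega, huw ▸ hw⟩
    · exact ⟨i, hsi, hit.le, hp u hE huw⟩

/-- Visiting the root of a subtree of height `2 n + 1`, starting and ending with that subtree empty,
takes `n + 2` simultaneous pebbles in the subtree. -/
lemma exists_le_subtreePebbles {H : ℕ} {B W : ℕ → Finset ℕ} (n : ℕ) :
    ∀ {s m t v : ℕ}, 1 ≤ v → (v + 1) * 2 ^ (2 * n + 1) ≤ 2 ^ (H + 1) →
      (∀ i, s ≤ i → i < t → BWMove (TreeEdge H) (B i) (W i) (B (i + 1)) (W (i + 1))) →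
      s ≤ m → m ≤ t → v ∈ B m ∪ W m → (∀ u ∈ B s ∪ W s, ¬ InSubtree v u) →
      (∀ u ∈ B t ∪ W t, ¬ InSubtree v u) →
      ∃ i, s ≤ i ∧ i ≤ t ∧ n + 2 ≤ subtreePebbles (B i ∪ W i) v := by
  induction n with
  | zero =>
    intro s m t v hv hH hmove hsm hmt hm hs ht
    have h₀ : TreeEdge H (2 * v) v := ⟨by omega, by omega, by omega⟩
    have h₁ : TreeEdge H (2 * v + 1) v := ⟨by omega, by omega, by omega⟩
    have s₀ : InSubtree v (2 * v) := (InSubtree.refl _).of_half (by omega)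
    have s₁ : InSubtree v (2 * v + 1) := (InSubtree.refl _).of_half (by omega)
    obtain ⟨i, hsi, hit, hp | ⟨w, -, hvi, hp, -⟩⟩ := exists_preds_pebbled hmove hsm hmt
      (fun h => hs v h (InSubtree.refl v)) hm (fun h => ht v h (InSubtree.refl v))
    · exact ⟨i, hsi, hit.le, two_le_subtreePebbles (hp _ h₀) (hp _ h₁) (by omega) s₀ s₁⟩
    · refine ⟨i, hsi, hit.le, ?_⟩
      by_cases hw : 2 * v = w
      · exact two_le_subtreePebbles hvi (hp _ h₁ (by omega)) (by omega) (InSubtree.refl v) s₁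
      · exact two_le_subtreePebbles hvi (hp _ h₀ hw) (by omega) (InSubtree.refl v) s₀
  | succ n ih =>
    intro s m t v hv hH hmove hsm hmt hm hs ht
    by_contra! hlt
    have hpow : 1 ≤ 2 ^ (2 * n + 1) := Nat.one_le_two_pow
    have hH' : (v + 1) * 4 * 2 ^ (2 * n + 1) ≤ 2 ^ (H + 1) := by
      calc _ = (v + 1) * 2 ^ (2 * (n + 1) + 1) := by ring
        _ ≤ _ := hH
    have hH4 : (v + 1) * 4 ≤ 2 ^ (H + 1) := by nlinarith
    let good : ℕ → Prop := fun i => v ∉ B i ∪ W i ∧ 2 * v ∉ B i ∪ W i ∧ 2 * v + 1 ∉ B i ∪ W i ∧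
      ∃ a, a < 4 ∧ ∀ b, b < 4 → b ≠ a → ∀ u ∈ B i ∪ W i, ¬ InSubtree (4 * v + b) u
    have s₀ : InSubtree v (2 * v) := (InSubtree.refl _).of_half (by omega)
    have s₁ : InSubtree v (2 * v + 1) := (InSubtree.refl _).of_half (by omega)
    have good_of_empty : ∀ i, (∀ u ∈ B i ∪ W i, ¬ InSubtree v u) → good i := fun i hi =>
      ⟨fun h => hi _ h (InSubtree.refl v), fun h => hi _ h s₀, fun h => hi _ h s₁,
        0, by omega, fun b hb _ u hu hs => hi u hu (hs.of_grandchild hb)⟩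
    have good_of_full : ∀ i a, s ≤ i → i ≤ t → a < 4 →
        n + 2 ≤ subtreePebbles (B i ∪ W i) (4 * v + a) → good i := by
      intro i a hsi hit ha hfull
      have hout : ∀ u ∈ B i ∪ W i, InSubtree v u → InSubtree (4 * v + a) u := by
        intro u hu huv
        by_contra huw
        have h₁ := subtreePebbles_lt (fun x hx => hx.of_grandchild ha) hu huv huw
        have h₂ := hlt i hsi hit
        omega
      refine ⟨fun h => ?_, fun h => ?_, fun h => ?_, a, ha, fun b hb hba u hu hs => ?_⟩
      · exact InSubtree.not_of_lt (by omega) (hout _ h (InSubtree.refl v))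
      · exact InSubtree.not_of_lt (by omega) (hout _ h s₀)
      · exact InSubtree.not_of_lt (by omega) (hout _ h s₁)
      · have := hs.unique (hout u hu (hs.of_grandchild hb)) (by omega) (by omega)
        omega
    have no_good_interval : ∀ d s' t', s ≤ s' → t' ≤ t → t' - s' = d → s' ≤ m → m ≤ t' →
        good s' → good t' → False := by
      intro d
      induction d using Nat.strong_induction_on with
      | _ d ihd =>
        intro s' t' hs' ht' hd hsm' hmt' gs gt
        obtain ⟨a, ha, hsa⟩ := gs.2.2.2
        obtain ⟨b, hb, htb⟩ := gt.2.2.2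
        obtain ⟨c, hc, hca, hcb⟩ : ∃ c, c < 4 ∧ c ≠ a ∧ c ≠ b := by
          by_contra! h
          have h0 := h 0
          have h1 := h 1
          have h2 := h 2
          omega
        have hmove' : ∀ i, s' ≤ i → i < t' →
            BWMove (TreeEdge H) (B i) (W i) (B (i + 1)) (W (i + 1)) :=
          fun i h₁ h₂ => hmove i (by omega) (by omega)
        have hchild : TreeEdge H (2 * v + c / 2) v := ⟨by omega, by omega, by omega⟩
        have hgrand : TreeEdge H (4 * v + c) (2 * v + c / 2) := ⟨by omega, by omega, by omega⟩
        obtain ⟨i, hi₁, hi₂, hi⟩ := exists_pred_pebbled hmove' hsm' hmt' gs.1 hm gt.1 hchild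
        have hsc : 2 * v + c / 2 ∉ B s' ∪ W s' := by
          obtain h | h : c / 2 = 0 ∨ c / 2 = 1 := by omega
          · rw [h]; exact gs.2.1
          · rw [h]; exact gs.2.2.1
        have htc : 2 * v + c / 2 ∉ B t' ∪ W t' := by
          obtain h | h : c / 2 = 0 ∨ c / 2 = 1 := by omega
          · rw [h]; exact gt.2.1
          · rw [h]; exact gt.2.2.1
        obtain ⟨j, hj₁, hj₂, hj⟩ := exists_pred_pebbled hmove' hi₁ hi₂ hsc hi htc hgrand
        obtain ⟨x, hx₁, hx₂, hx⟩ := ih (v := 4 * v + c) (by omega)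
          (le_trans (Nat.mul_le_mul_right _ (by omega)) hH') hmove' hj₁ hj₂ hj
          (hsa c hc hca) (htb c hc hcb)
        have gx : good x := good_of_full x c (by omega) (by omega) hc hx
        have hxs : x ≠ s' := by
          rintro rfl
          have := subtreePebbles_eq_zero (hsa c hc hca)
          omega
        have hxt : x ≠ t' := by
          rintro rfl
          have := subtreePebbles_eq_zero (htb c hc hcb)
          omega
        rcases le_total x m with hxm | hxm
        · exact ihd (t' - x) (by omega) x t' (by omega) ht' rfl hxm hmt' gx gt
        · exact ihd (x - s') (by omega) s' x hs' (by omega) rfl hsm' hxm gs gx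
    exact no_good_interval _ s t le_rfl le_rfl rfl hsm hmt (good_of_empty s hs) (good_of_empty t ht)

/-- Reversing time and exchanging the two colours turns legal moves into legal moves. -/
lemma BWMove.reverse {V : Type} [DecidableEq V] {E : V → V → Prop} {B W B' W' : Finset V}
    (hE : ∀ v, ¬ E v v) (hd : Disjoint B W) (h : BWMove E B W B' W') : BWMove E W' B' W B := by
  have hd' : ∀ x, x ∈ B → x ∉ W := fun _ hx => Finset.disjoint_left.1 hd hx
  rcases h with ⟨v, hB, hW, hp, rfl, rfl⟩ | ⟨v, hB, rfl, rfl⟩ | ⟨v, hB, hW, rfl, rfl⟩ |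
    ⟨v, hW, hp, rfl, rfl⟩ | ⟨v, w, hv, hB, hW, he, hp, rfl, rfl⟩ |
    ⟨v, w, hw, hB, hW, he, hp, rfl, rfl⟩
  · refine Or.inr <| Or.inr <| Or.inr <| Or.inl ⟨v, by simp, fun u hu => ?_, rfl, ?_⟩
    · have := hp u hu
      grind
    · rw [Finset.erase_insert hB]
  · refine Or.inr <| Or.inr <| Or.inl ⟨v, hd' v hB, by simp, rfl, ?_⟩
    rw [Finset.insert_erase hB]
  · refine Or.inr <| Or.inl ⟨v, by simp, ?_, rfl⟩
    rw [Finset.erase_insert hW]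
  · refine Or.inl ⟨v, by simp, fun h => hd' v h hW, fun u hu => ?_, ?_, rfl⟩
    · have := hp u hu
      have : u ≠ v := fun h => hE v (h ▸ hu)
      grind
    · rw [Finset.insert_erase hW]
  · refine Or.inr <| Or.inr <| Or.inr <| Or.inr <| Or.inr
      ⟨v, w, by simp, hd' v hv, ?_, he, fun u hu huv => ?_, rfl, ?_⟩
    · have : v ≠ w := fun h => hB (h ▸ hv)
      simp [this]
    · have := hp u hu
      grind
    · rw [Finset.erase_insert (by simp [hB]), Finset.insert_erase hv]
  · refine Or.inr <| Or.inr <| Or.inr <| Or.inr <| Or.inl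
      ⟨v, w, by simp, ?_, fun h => hd' w h hw, he, fun u hu => ?_, ?_, rfl⟩
    · have : w ≠ v := fun h => hW (h ▸ hw)
      simp [this]
    · have : u ≠ w := fun h => hE w (h ▸ hu)
      by_cases huv : u = v
      · grind
      · have := hp u hu huv
        grind
    · rw [Finset.erase_insert (by simp [hW]), Finset.insert_erase hw]

/-- Configurations on the tree `T_H` with at most `k` pebbles. -/
structure Bounded (H k : ℕ) (B W : Finset ℕ) : Prop where
  disjoint : Disjoint B W
  black_subset : B ⊆ Finset.Icc 1 (2 ^ (H + 1) - 1)
  white_subset : W ⊆ Finset.Icc 1 (2 ^ (H + 1) - 1)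
  card_le : B.card + W.card ≤ k

namespace Bounded

variable {H k : ℕ} {B W : Finset ℕ}

lemma mono {k' : ℕ} (h : Bounded H k B W) (hk : k ≤ k') : Bounded H k' B W :=
  ⟨h.1, h.2, h.3, h.4.trans hk⟩

lemma symm (h : Bounded H k B W) : Bounded H k W B :=
  ⟨h.1.symm, h.3, h.2, by have := h.4; omega⟩

lemma insert_black (h : Bounded H k B W) {v : ℕ} (hv : v ∈ Finset.Icc 1 (2 ^ (H + 1) - 1))
    (hW : v ∉ W) : Bounded H (k + 1) (insert v B) W := by
  refine ⟨Finset.disjoint_insert_left.2 ⟨hW, h.1⟩, Finset.insert_subset hv h.2, h.3, ?_⟩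
  have := Finset.card_insert_le v B
  have := h.4
  omega

lemma insert_white (h : Bounded H k B W) {v : ℕ} (hv : v ∈ Finset.Icc 1 (2 ^ (H + 1) - 1))
    (hB : v ∉ B) : Bounded H (k + 1) B (insert v W) :=
  (h.symm.insert_black hv hB).symm

end Bounded

/-- A legal move between configurations with at most `k` pebbles. -/
def BoundedMove (H k : ℕ) (c d : Finset ℕ × Finset ℕ) : Prop :=
  Bounded H k c.1 c.2 ∧ Bounded H k d.1 d.2 ∧ BWMove (TreeEdge H) c.1 c.2 d.1 d.2

/-- Reachability within `k` pebbles. -/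
def Reach (H k : ℕ) : Finset ℕ × Finset ℕ → Finset ℕ × Finset ℕ → Prop :=
  Relation.ReflTransGen (BoundedMove H k)

namespace Reach

variable {H k : ℕ} {B W : Finset ℕ} {c d e : Finset ℕ × Finset ℕ}

lemma trans (h₁ : Reach H k c d) (h₂ : Reach H k d e) : Reach H k c e :=
  Relation.ReflTransGen.trans h₁ h₂

lemma mono {k' : ℕ} (hk : k ≤ k') (h : Reach H k c d) : Reach H k' c d :=
  Relation.ReflTransGen.mono (r := BoundedMove H k) (p := BoundedMove H k')
    (fun _ _ m => ⟨m.1.mono hk, m.2.1.mono hk, m.2.2⟩) _ _ h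

lemma reverse (h : Reach H k c d) : Reach H k d.swap c.swap := by
  induction h with
  | refl => exact Relation.ReflTransGen.refl
  | tail _ hm ih =>
    refine Relation.ReflTransGen.head ⟨hm.2.1.symm, hm.1.symm, hm.2.2.reverse ?_ hm.1.1⟩ ih
    rintro v ⟨h₁, -, h₂⟩
    omega

lemma place_black {v : ℕ} (h : Bounded H k B W) (h' : Bounded H k (insert v B) W)
    (hv : v ∉ B) (hp : ∀ u, TreeEdge H u v → u ∈ B ∪ W) : Reach H k (B, W) (insert v B, W) :=
  Relation.ReflTransGen.single ⟨h, h', Or.inl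
    ⟨v, hv, Finset.disjoint_left.1 h'.1 (Finset.mem_insert_self v B), hp, rfl, rfl⟩⟩

lemma remove_black {v : ℕ} (h' : Bounded H k (insert v B) W) (hv : v ∉ B) :
    Reach H k (insert v B, W) (B, W) := by
  refine Relation.ReflTransGen.single ⟨h', ?_, Or.inr <| Or.inl
    ⟨v, by simp, by simp [Finset.erase_insert hv], rfl⟩⟩
  refine ⟨h'.1.mono_left (Finset.subset_insert v B), (Finset.subset_insert v B).trans h'.2,
    h'.3, ?_⟩
  have := h'.4
  rw [Finset.card_insert_of_notMem hv] at this
  simp only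
  omega

lemma place_white {v : ℕ} (h' : Bounded H k B (insert v W))
    (hv : v ∉ W) : Reach H k (B, W) (B, insert v W) :=
  (remove_black h'.symm hv).reverse

lemma slide_black {v w : ℕ} (h : Bounded H k (insert v B) W) (h' : Bounded H k (insert w B) W)
    (hvB : v ∉ B) (hwB : w ∉ B) (he : TreeEdge H v w)
    (hp : ∀ u, TreeEdge H u w → u ∈ insert v B ∪ W) :
    Reach H k (insert v B, W) (insert w B, W) := by
  have hne : w ≠ v := by
    obtain ⟨h₁, -, h₂⟩ := he
    omega
  exact Relation.ReflTransGen.single ⟨h, h', Or.inr <| Or.inr <| Or.inr <| Or.inr <| Or.inl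
    ⟨v, w, by simp, by simp [hne, hwB],
      Finset.disjoint_left.1 h'.1 (Finset.mem_insert_self w B), he, hp,
      by simp [Finset.erase_insert hvB], rfl⟩⟩

lemma exists_seq (h : Reach H k c d) : ∃ (τ : ℕ) (f : ℕ → Finset ℕ × Finset ℕ),
    f 0 = c ∧ f τ = d ∧ ∀ i < τ, BoundedMove H k (f i) (f (i + 1)) := by
  induction h using Relation.ReflTransGen.head_induction_on with
  | refl => exact ⟨0, fun _ => d, rfl, rfl, by simp⟩
  | head hm _ ih =>
    rename_i a b _
    obtain ⟨τ, f, h₀, hτ, hf⟩ := ih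
    refine ⟨τ + 1, fun i => Nat.casesOn i a f, rfl, hτ, fun i hi => ?_⟩
    cases i with
    | zero => simpa [h₀] using hm
    | succ i => exact hf i (by omega)

end Reach

lemma TreeEdge.eq_or_eq {H u v : ℕ} (h : TreeEdge H u v) : u = 2 * v ∨ u = 2 * v + 1 := by
  obtain ⟨-, -, h⟩ := h
  omega

/-- With `n + 2` additional pebbles one can put a black pebble on the root of an empty subtree of
height `2 n + 1`, leaving the rest of the configuration unchanged. -/
lemma reach_insert_black {H : ℕ} (n : ℕ) : ∀ {c v : ℕ} {B W : Finset ℕ}, 1 ≤ v →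
    (v + 1) * 2 ^ (2 * n + 1) ≤ 2 ^ (H + 1) → 2 ^ (H + 1) ≤ v * 2 ^ (2 * n + 2) →
    Bounded H c B W → (∀ u ∈ B ∪ W, ¬ InSubtree v u) →
    Reach H (c + (n + 2)) (B, W) (insert v B, W) := by
  induction n with
  | zero =>
    intro c v B W hv hlo hhi hc hempty
    have hvm : v ∉ B ∧ v ∉ W := by
      simpa using fun h => hempty v h (InSubtree.refl v)
    have ham : 2 * v ∉ B ∧ 2 * v ∉ W := by
      simpa using fun h => hempty (2 * v) h ((InSubtree.refl _).of_half (by omega))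
    have hbm : 2 * v + 1 ∉ B ∧ 2 * v + 1 ∉ W := by
      simpa using fun h => hempty (2 * v + 1) h ((InSubtree.refl _).of_half (by omega))
    have hvI : v ∈ Finset.Icc 1 (2 ^ (H + 1) - 1) := Finset.mem_Icc.2 ⟨by omega, by omega⟩
    have haI : 2 * v ∈ Finset.Icc 1 (2 ^ (H + 1) - 1) := Finset.mem_Icc.2 ⟨by omega, by omega⟩
    have hbI : 2 * v + 1 ∈ Finset.Icc 1 (2 ^ (H + 1) - 1) :=
      Finset.mem_Icc.2 ⟨by omega, by omega⟩
    have ca := hc.insert_black haI ham.2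
    have r₁ : Reach H (c + 2) (B, W) (insert (2 * v) B, W) :=
      Reach.place_black (hc.mono (by omega)) (ca.mono (by omega)) ham.1 (by
        rintro u ⟨h₁, h₂, h₃⟩
        omega)
    have r₂ : Reach H (c + 2) (insert (2 * v) B, W) (insert (2 * v + 1) (insert (2 * v) B), W) :=
      Reach.place_black (ca.mono (by omega)) (ca.insert_black hbI hbm.2) (by simp [hbm.1]) (by
        rintro u ⟨h₁, h₂, h₃⟩
        omega)
    have r₃ : Reach H (c + 2) (insert (2 * v + 1) (insert (2 * v) B), W)
        (insert v (insert (2 * v) B), W) :=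
      Reach.slide_black (ca.insert_black hbI hbm.2) (ca.insert_black hvI hvm.2) (by simp [hbm.1])
        (by simp [hvm.1]; omega) ⟨by omega, by omega, by omega⟩ (by
          intro u hu
          rcases hu.eq_or_eq with rfl | rfl <;> simp)
    rw [Finset.insert_comm v] at r₃
    have r₄ : Reach H (c + 2) (insert (2 * v) (insert v B), W) (insert v B, W) :=
      Reach.remove_black (by rw [Finset.insert_comm]; exact ca.insert_black hvI hvm.2)
        (by simp [ham.1]; omega)
    exact r₁.trans (r₂.trans (r₃.trans r₄))
  | succ n ih =>
    intro c v B W hv hlo hhi hc hempty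
    have hpow : 1 ≤ 2 ^ (2 * n + 1) := Nat.one_le_two_pow
    have hlo' : (v + 1) * 4 * 2 ^ (2 * n + 1) ≤ 2 ^ (H + 1) := by
      calc _ = (v + 1) * 2 ^ (2 * (n + 1) + 1) := by ring
        _ ≤ _ := hlo
    have hhi' : 2 ^ (H + 1) ≤ v * 4 * 2 ^ (2 * n + 2) := by
      calc _ ≤ v * 2 ^ (2 * (n + 1) + 2) := hhi
        _ = _ := by ring
    have hlo4 : (v + 1) * 4 ≤ 2 ^ (H + 1) := by nlinarith
    have hI : ∀ x, 1 ≤ x → x ≤ 4 * v + 3 → x ∈ Finset.Icc 1 (2 ^ (H + 1) - 1) :=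
      fun x h₁ h₂ => Finset.mem_Icc.2 ⟨h₁, by omega⟩
    have hout : ∀ x, InSubtree v x → x ∉ B ∧ x ∉ W := fun x hx => by
      simpa using fun h => hempty x h hx
    have hvm := hout v (InSubtree.refl v)
    have ham := hout (2 * v) ((InSubtree.refl _).of_half (by omega))
    have hbm := hout (2 * v + 1) ((InSubtree.refl _).of_half (by omega))
    have hgm : ∀ j < 4, 4 * v + j ∉ B ∧ 4 * v + j ∉ W := fun j hj =>
      hout _ ((InSubtree.refl _).of_grandchild hj)
    have hgs : ∀ j < 4, ∀ u ∈ B ∪ W, ¬ InSubtree (4 * v + j) u := fun j hj u hu hs =>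
      hempty u hu (hs.of_grandchild hj)
    have hsib : ∀ i < 4, ∀ j < 4, i ≠ j → ¬ InSubtree (4 * v + j) (4 * v + i) :=
      fun i hi j hj hij hs => by
        have := hs.unique (InSubtree.refl _) (by omega) (by omega)
        omega
    have black : ∀ {j c' : ℕ} {B' W' : Finset ℕ}, j < 4 → Bounded H c' B' W' → c' ≤ c + 1 →
        (∀ u ∈ B' ∪ W', ¬ InSubtree (4 * v + j) u) →
        Reach H (c + (n + 1 + 2)) (B', W') (insert (4 * v + j) B', W') :=
      fun {j c' B' W'} hj hb hc' he => (ih (by omega)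
        (le_trans (Nat.mul_le_mul_right _ (by omega)) hlo')
        (le_trans hhi' (Nat.mul_le_mul_right _ (by omega))) hb he).mono (by omega)
    have white : ∀ {j c' : ℕ} {B' W' : Finset ℕ}, j < 4 → Bounded H c' B' W' → c' ≤ c + 1 →
        (∀ u ∈ B' ∪ W', ¬ InSubtree (4 * v + j) u) →
        Reach H (c + (n + 1 + 2)) (B', insert (4 * v + j) W') (B', W') :=
      fun {j c' B' W'} hj hb hc' he =>
        (black hj hb.symm hc' (by rwa [Finset.union_comm])).reverse
    have cg : Bounded H (c + 1) (insert (4 * v) B) W :=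
      hc.insert_black (hI _ (by omega) (by omega)) (hgm 0 (by omega)).2
    have ca : Bounded H (c + 1) (insert (2 * v) B) W :=
      hc.insert_black (hI _ (by omega) (by omega)) ham.2
    have cv : Bounded H (c + 1) (insert v B) W :=
      hc.insert_black (hI _ (by omega) (by omega)) hvm.2
    have r₁ : Reach H (c + (n + 1 + 2)) (B, W) (insert (4 * v) B, W) :=
      black (j := 0) (by omega) hc (by omega) (hgs 0 (by omega))
    have r₂ : Reach H (c + (n + 1 + 2)) (insert (4 * v) B, W)
        (insert (4 * v + 1) (insert (4 * v) B), W) := by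
      refine black (j := 1) (by omega) cg le_rfl fun u hu => ?_
      rw [Finset.insert_union, Finset.mem_insert] at hu
      rcases hu with rfl | hu
      · exact hsib 0 (by omega) 1 (by omega) (by omega)
      · exact hgs 1 (by omega) u hu
    have r₃ : Reach H (c + (n + 1 + 2)) (insert (4 * v + 1) (insert (4 * v) B), W)
        (insert (2 * v) (insert (4 * v) B), W) := by
      refine Reach.slide_black
        ((cg.insert_black (hI _ (by omega) (by omega)) (hgm 1 (by omega)).2).mono (by omega))
        ((cg.insert_black (hI _ (by omega) (by omega)) ham.2).mono (by omega))
        (by simp [(hgm 1 (by omega)).1]) (by simp [ham.1]; omega)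
        ⟨by omega, by omega, by omega⟩ fun u hu => ?_
      obtain h | h : u = 4 * v ∨ u = 4 * v + 1 := by
        rcases hu.eq_or_eq with h | h <;> omega
      all_goals simp [h]
    have r₄ : Reach H (c + (n + 1 + 2)) (insert (2 * v) (insert (4 * v) B), W)
        (insert (2 * v) B, W) := by
      rw [Finset.insert_comm]
      exact Reach.remove_black
        ((ca.insert_black (hI _ (by omega) (by omega)) (hgm 0 (by omega)).2).mono (by omega))
        (by have := (hgm 0 (by omega)).1; simp at this; simp [this]; omega)
    have r₅ : Reach H (c + (n + 1 + 2)) (insert (2 * v) B, W)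
        (insert (4 * v + 2) (insert (2 * v) B), W) := by
      refine black (j := 2) (by omega) ca le_rfl fun u hu => ?_
      rw [Finset.insert_union, Finset.mem_insert] at hu
      rcases hu with rfl | hu
      · exact InSubtree.not_of_lt (by omega)
      · exact hgs 2 (by omega) u hu
    have cw : Bounded H (c + 2) (insert (2 * v) B) (insert (4 * v + 3) W) :=
      ca.insert_white (hI _ (by omega) (by omega)) (by simp [(hgm 3 (by omega)).1]; omega)
    have cwg : Bounded H (c + 3) (insert (4 * v + 2) (insert (2 * v) B)) (insert (4 * v + 3) W) :=
      cw.insert_black (hI _ (by omega) (by omega)) (by simp [(hgm 2 (by omega)).2])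
    have cwb : Bounded H (c + 3) (insert (2 * v + 1) (insert (2 * v) B)) (insert (4 * v + 3) W) :=
      cw.insert_black (hI _ (by omega) (by omega)) (by simp [hbm.2]; omega)
    have cwv : Bounded H (c + 3) (insert v (insert (2 * v) B)) (insert (4 * v + 3) W) :=
      cw.insert_black (hI _ (by omega) (by omega)) (by simp [hvm.2]; omega)
    have r₆ : Reach H (c + (n + 1 + 2)) (insert (4 * v + 2) (insert (2 * v) B), W)
        (insert (4 * v + 2) (insert (2 * v) B), insert (4 * v + 3) W) :=
      Reach.place_white (cwg.mono (by omega)) (hgm 3 (by omega)).2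
    have r₇ : Reach H (c + (n + 1 + 2))
        (insert (4 * v + 2) (insert (2 * v) B), insert (4 * v + 3) W)
        (insert (2 * v + 1) (insert (2 * v) B), insert (4 * v + 3) W) := by
      refine Reach.slide_black (cwg.mono (by omega)) (cwb.mono (by omega))
        (by simp [(hgm 2 (by omega)).1]; omega) (by simp [hbm.1])
        ⟨by omega, by omega, by omega⟩ fun u hu => ?_
      obtain h | h : u = 4 * v + 2 ∨ u = 4 * v + 3 := by
        rcases hu.eq_or_eq with h | h <;> omega
      all_goals simp [h]
    have r₈ : Reach H (c + (n + 1 + 2))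
        (insert (2 * v + 1) (insert (2 * v) B), insert (4 * v + 3) W)
        (insert v (insert (2 * v) B), insert (4 * v + 3) W) := by
      refine Reach.slide_black (cwb.mono (by omega)) (cwv.mono (by omega))
        (by simp [hbm.1]) (by simp [hvm.1]; omega)
        ⟨by omega, by omega, by omega⟩ fun u hu => ?_
      rcases hu.eq_or_eq with rfl | rfl <;> simp
    have r₉ : Reach H (c + (n + 1 + 2))
        (insert v (insert (2 * v) B), insert (4 * v + 3) W)
        (insert v B, insert (4 * v + 3) W) := by
      rw [Finset.insert_comm] at cwv ⊢
      exact Reach.remove_black (cwv.mono (by omega)) (by simp [ham.1]; omega)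
    have r₁₀ : Reach H (c + (n + 1 + 2)) (insert v B, insert (4 * v + 3) W) (insert v B, W) := by
      refine white (j := 3) (by omega) cv le_rfl fun u hu => ?_
      rw [Finset.insert_union, Finset.mem_insert] at hu
      rcases hu with rfl | hu
      · exact InSubtree.not_of_lt (by omega)
      · exact hgs 3 (by omega) u hu
    exact r₁.trans <| r₂.trans <| r₃.trans <| r₄.trans <| r₅.trans <| r₆.trans <| r₇.trans <|
      r₈.trans <| r₉.trans r₁₀

/-- For odd `h ≥ 1`, in the black-white pebble game on the complete binary
tree `T_h`, any valid strategy whose first move places a white pebble on the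
root and which ends with no pebbles on the tree uses at least `⌊(h+3)/2⌋`
pebbles, and `⌊(h+3)/2⌋` pebbles suffice for such a strategy. -/
theorem bw_white_root_tree_cost (h : ℕ) (hh : 1 ≤ h) (hodd : Odd h) :
    (∀ (τ : ℕ) (B W : ℕ → Finset ℕ),
      1 ≤ τ →
      B 0 = ∅ → W 0 = ∅ →
      B 1 = ∅ → W 1 = {1} →
      B τ = ∅ → W τ = ∅ →
      (∀ i ≤ τ, B i ⊆ Finset.Icc 1 (2 ^ (h + 1) - 1) ∧
        W i ⊆ Finset.Icc 1 (2 ^ (h + 1) - 1)) →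
      (∀ i ≤ τ, Disjoint (B i) (W i)) →
      (∀ i < τ, BWMove (TreeEdge h) (B i) (W i) (B (i + 1)) (W (i + 1))) →
      ∃ i ≤ τ, (h + 3) / 2 ≤ (B i).card + (W i).card) ∧
    (∃ (τ : ℕ) (B W : ℕ → Finset ℕ),
      1 ≤ τ ∧
      B 0 = ∅ ∧ W 0 = ∅ ∧
      B 1 = ∅ ∧ W 1 = {1} ∧
      B τ = ∅ ∧ W τ = ∅ ∧
      (∀ i ≤ τ, B i ⊆ Finset.Icc 1 (2 ^ (h + 1) - 1) ∧
        W i ⊆ Finset.Icc 1 (2 ^ (h + 1) - 1)) ∧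
      (∀ i ≤ τ, Disjoint (B i) (W i)) ∧
      (∀ i < τ, BWMove (TreeEdge h) (B i) (W i) (B (i + 1)) (W (i + 1))) ∧
      (∀ i ≤ τ, (B i).card + (W i).card ≤ (h + 3) / 2)) := by
  obtain ⟨n, rfl⟩ := hodd
  have hk : (2 * n + 1 + 3) / 2 = n + 2 := by omega
  rw [hk]
  constructor
  · intro τ B W hτ hB₀ hW₀ hB₁ hW₁ hBτ hWτ _ _ hmove
    obtain ⟨i, -, hi, hcard⟩ := exists_le_subtreePebbles (H := 2 * n + 1) (B := B) (W := W) n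
      (s := 0) (m := 1) (t := τ) (v := 1) le_rfl (by rw [pow_succ 2 (2 * n + 1)]; omega)
      (fun i _ hi => hmove i hi) (by omega) hτ (by simp [hW₁]) (by simp [hB₀, hW₀])
      (by simp [hBτ, hWτ])
    refine ⟨i, hi, hcard.trans ?_⟩
    exact (subtreePebbles_le_card _ _).trans (Finset.card_union_le _ _)
  · have hone : 1 ∈ Finset.Icc 1 (2 ^ (2 * n + 1 + 1) - 1) := by
      have : 2 ≤ 2 ^ (2 * n + 1 + 1) := Nat.le_self_pow (by omega) 2
      exact Finset.mem_Icc.2 ⟨le_rfl, by omega⟩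
    have h₀ : Bounded (2 * n + 1) 0 ∅ ∅ := ⟨by simp, by simp, by simp, by simp⟩
    have h₁ : Bounded (2 * n + 1) 1 ∅ {1} := h₀.insert_white hone (by simp)
    have hr : Reach (2 * n + 1) (n + 2) (∅, {1}) (∅, ∅) := by
      have := reach_insert_black (H := 2 * n + 1) n (v := 1) le_rfl
        (by rw [pow_succ 2 (2 * n + 1)]; omega) (by rw [one_mul]) h₀ (by simp)
      simpa using this.reverse
    obtain ⟨τ, f, hf₀, hfτ, hf⟩ := hr.exists_seq
    have hb : ∀ i ≤ τ, Bounded (2 * n + 1) (n + 2) (f i).1 (f i).2 := by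
      intro i hi
      rcases hi.lt_or_eq with hi | rfl
      · exact (hf i hi).1
      · rw [hfτ]
        exact h₀.mono (by omega)
    let g : ℕ → Finset ℕ × Finset ℕ := fun i => Nat.casesOn i (∅, ∅) f
    have hg : ∀ i ≤ τ + 1, Bounded (2 * n + 1) (n + 2) (g i).1 (g i).2 := by
      intro i hi
      cases i with
      | zero => exact h₀.mono (by omega)
      | succ i => exact hb i (by omega)
    refine ⟨τ + 1, fun i => (g i).1, fun i => (g i).2, by omega, rfl, rfl, ?_, ?_, ?_, ?_,
      fun i hi => ⟨(hg i hi).2, (hg i hi).3⟩, fun i hi => (hg i hi).1, fun i hi => ?_,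
      fun i hi => (hg i hi).4⟩
    · simp [g, hf₀]
    · simp [g, hf₀]
    · simp [g, hfτ]
    · simp [g, hfτ]
    · cases i with
      | zero => exact Or.inr <| Or.inr <| Or.inl ⟨1, by simp [g], by simp [g], by simp [g, hf₀],
          by simp [g, hf₀]⟩
      | succ i => exact (hf i (by omega)).2.2
end
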